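/- arXiv:1606.06807 — 2 statements merged into one kernel-verified Lean document; each statement's English description precedes it below -/
import Mathlib

section
/- Let p be a prime and let R be either the field ℚ of rational numbers or the field ℤ_p = ℤ/pℤ of p elements. If Γ is a poly-torsion-free-abelian (PTFA) group, then the group ring RΓ is an Ore domain: the set of nonzero elements of RΓ satisfies the right Ore condition, i.e., for every x ∈ RΓ and every nonzero s ∈ RΓ there exist y ∈ RΓ and a nonzero t ∈ RΓ with x·t = s·y. Consequently RΓ embeds into a skew quotient field: there exist a division ring 𝒦 and an injective ring homomorphism ι : RΓ → 𝒦 such that every element of 𝒦 is of the form ι(a)·ι(b)⁻¹ for some a, b ∈ RΓ with b ≠ 0. -/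
universe u

/-- A group `Γ` is poly-torsion-free-abelian (PTFA) if it admits a finite subnormal chain
`{1} = Γ_k ⊴ Γ_{k-1} ⊴ ⋯ ⊴ Γ_0 = Γ` (here `s i` is `Γ_i`) such that each `Γ_{i+1}` is normal
in `Γ_i` and each successive quotient `Γ_i/Γ_{i+1}` is abelian and torsion-free (all conditions
expressed elementwise). -/
def IsPTFA (Γ : Type*) [Group Γ] : Prop :=
  ∃ (k : ℕ) (s : ℕ → Subgroup Γ),
    s 0 = ⊤ ∧ s k = ⊥ ∧
    (∀ i, i < k → s (i + 1) ≤ s i) ∧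
    (∀ i, i < k → ∀ x ∈ s i, ∀ y ∈ s (i + 1), x * y * x⁻¹ ∈ s (i + 1)) ∧
    (∀ i, i < k → ∀ x ∈ s i, ∀ y ∈ s i, x * y * x⁻¹ * y⁻¹ ∈ s (i + 1)) ∧
    (∀ i, i < k → ∀ x ∈ s i, ∀ m : ℕ, 0 < m → x ^ m ∈ s (i + 1) → x ∈ s (i + 1))

/-- The nonzero elements of `A` satisfy the right Ore condition: for every `x ∈ A` and every
nonzero `s ∈ A` there exist `y ∈ A` and a nonzero `t ∈ A` with `x·t = s·y`. -/
def RightOreCondition (A : Type*) [Ring A] : Prop :=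
  ∀ x s : A, s ≠ 0 → ∃ y t : A, t ≠ 0 ∧ x * t = s * y

/-- `A` embeds into a skew quotient field: there are a division ring `K` and an injective ring
homomorphism `ι : A → K` such that every element of `K` has the form `ι(a)·ι(b)⁻¹` with `b ≠ 0`. -/
def EmbedsInSkewQuotientField (A : Type u) [Ring A] : Prop :=
  ∃ (K : Type u) (_ : DivisionRing K) (ι : A →+* K),
    Function.Injective ι ∧ ∀ q : K, ∃ a b : A, b ≠ 0 ∧ q = ι a * (ι b)⁻¹

open scoped Pointwise nonZeroDivisors

section Folner

open scoped Classical in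
/-- `G` satisfies the Følner condition: every finite set `S` admits finite nonempty sets `F` for
which `S * F` is at most `c` times as large as `F`, with `c > 1` arbitrarily close to `1`. -/
def HasFolnerSets (G : Type*) [Group G] : Prop :=
  ∀ (S : Finset G) (c : ℝ), 1 < c → ∃ F : Finset G, F.Nonempty ∧ ((S * F).card : ℝ) ≤ c * F.card

open scoped Classical in
theorem HasFolnerSets.of_commGroup (Q : Type*) [CommGroup Q] : HasFolnerSets Q := by
  intro S c hc
  let B : ℕ → Finset Q := fun N ↦
    Finset.univ.image fun e : S → Fin (N + 1) ↦ ∏ x : S, (x : Q) ^ (e x : ℕ)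
  have hne (N : ℕ) : (B N).Nonempty := Finset.univ_nonempty.image _
  have hcard (N : ℕ) : (B N).card ≤ (N + 1) ^ S.card := by
    refine Finset.card_image_le.trans ?_
    simp
  have hsub (N : ℕ) : S * B N ⊆ B (N + 1) := by
    intro z hz
    obtain ⟨x, hx, b, hb, rfl⟩ := Finset.mem_mul.mp hz
    obtain ⟨e, -, rfl⟩ := Finset.mem_image.mp hb
    refine Finset.mem_image.mpr ⟨fun y ↦ if y = ⟨x, hx⟩ then (e y).succ else (e y).castSucc,
      Finset.mem_univ _, ?_⟩
    have : ∀ y : S, (y : Q) ^ ((if y = ⟨x, hx⟩ then (e y).succ else (e y).castSucc : Fin _) : ℕ) =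
        (if y = ⟨x, hx⟩ then (y : Q) else 1) * (y : Q) ^ (e y : ℕ) := by
      intro y
      split_ifs <;> simp [pow_succ']
    simp_rw [this, Finset.prod_mul_distrib]
    simp
  by_contra! h
  have hgrow (N : ℕ) : c ^ N ≤ (B N).card := by
    induction N with
    | zero => simpa using (hne 0).card_pos
    | succ N ih =>
      calc c ^ (N + 1) = c * c ^ N := pow_succ' ..
        _ ≤ c * (B N).card := by gcongr
        _ ≤ (S * B N).card := (h _ (hne N)).le
        _ ≤ (B (N + 1)).card := by exact_mod_cast Finset.card_le_card (hsub N)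
  have hlim := (tendsto_pow_const_div_const_pow_of_one_lt S.card hc).comp
    (Filter.tendsto_add_atTop_nat 1)
  obtain ⟨N, hN⟩ := (hlim.eventually_lt_const (inv_pos.mpr (zero_lt_one.trans hc))).exists
  have hc0 : 0 < c := zero_lt_one.trans hc
  simp only [Function.comp_apply] at hN
  rw [div_lt_iff₀ (by positivity), pow_succ', inv_mul_cancel_left₀ hc0.ne'] at hN
  have := (hgrow N).trans (Nat.cast_le.mpr (hcard N))
  push_cast at this hN
  linarith

open scoped Classical in
theorem HasFolnerSets.of_extension {N G Q : Type*} [Group N] [Group G] [Group Q]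
    (i : N →* G) (f : G →* Q) (hi : Function.Injective i) (hf : Function.Surjective f)
    (hex : f.ker = i.range) (hN : HasFolnerSets N) (hQ : HasFolnerSets Q) : HasFolnerSets G := by
  intro S c hc
  have hc' : 1 < √c := Real.lt_sqrt_of_sq_lt (by simpa using hc)
  obtain ⟨σ, hσ⟩ := hf.hasRightInverse
  have hfi (n : N) : f (i n) = 1 := by
    have : i n ∈ f.ker := hex ▸ ⟨n, rfl⟩
    exact this
  have hT (s : G) (q : Q) : ∃ n : N, σ (f s * q) * i n = s * σ q := by
    have : (σ (f s * q))⁻¹ * (s * σ q) ∈ f.ker := by simp [MonoidHom.mem_ker, hσ _]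
    rw [hex] at this
    obtain ⟨n, hn⟩ := this
    exact ⟨n, by simp [hn]⟩
  choose τ hτ using hT
  obtain ⟨F, hF, hFc⟩ := hQ (S.image f) _ hc'
  obtain ⟨E, hE, hEc⟩ := hN ((S ×ˢ F).image fun x ↦ τ x.1 x.2) _ hc'
  set T := (S ×ˢ F).image fun x ↦ τ x.1 x.2
  have hinj : Function.Injective fun x : Q × N ↦ σ x.1 * i x.2 := by
    rintro ⟨q, n⟩ ⟨q', n'⟩ h
    have h1 : q = q' := by simpa [hσ _, hfi] using congrArg f h
    subst h1
    simpa [hi.eq_iff] using h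
  refine ⟨(F ×ˢ E).image fun x ↦ σ x.1 * i x.2, (hF.product hE).image _, ?_⟩
  have hsub : S * (F ×ˢ E).image (fun x ↦ σ x.1 * i x.2) ⊆
      ((S.image f * F) ×ˢ (T * E)).image fun x ↦ σ x.1 * i x.2 := by
    intro z hz
    obtain ⟨s, hs, b, hb, rfl⟩ := Finset.mem_mul.mp hz
    obtain ⟨⟨q, n⟩, hqn, rfl⟩ := Finset.mem_image.mp hb
    obtain ⟨hq, hn⟩ := Finset.mem_product.mp hqn
    refine Finset.mem_image.mpr ⟨(f s * q, τ s q * n), Finset.mem_product.mpr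
      ⟨Finset.mul_mem_mul (Finset.mem_image_of_mem _ hs) hq,
        Finset.mul_mem_mul (Finset.mem_image.mpr ⟨(s, q), by simp_all, rfl⟩) hn⟩, ?_⟩
    simp [← mul_assoc, hτ]
  calc _ ≤ ((((S.image f * F) ×ˢ (T * E)).image fun x ↦ σ x.1 * i x.2).card : ℝ) := by
        exact_mod_cast Finset.card_le_card hsub
    _ = (S.image f * F).card * (T * E).card := by
        rw [Finset.card_image_of_injective _ hinj, Finset.card_product, Nat.cast_mul]
    _ ≤ (√c * F.card) * (√c * E.card) := by gcongr
    _ = (√c * √c) * (F.card * E.card) := by ring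
    _ = _ := by
        rw [Real.mul_self_sqrt (by linarith), Finset.card_image_of_injective _ hinj,
          Finset.card_product, Nat.cast_mul]

end Folner

section UniqueProds

theorem UniqueProds.of_isMulTorsionFree (Q : Type*) [CommGroup Q] [IsMulTorsionFree Q] :
    UniqueProds Q := by
  have h : TwoUniqueSums (Additive Q) := TwoUniqueSums.of_injective_addHom
    (DivisibleHull.coeAddMonoidHom (M := Additive Q)).toAddHom DivisibleHull.coe_injective inferInstance
  exact inferInstanceAs (UniqueProds (Multiplicative (Additive Q)))

theorem UniqueProds.of_extension {N G Q : Type*} [Group N] [Group G] [Group Q]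
    (i : N →* G) (f : G →* Q) (hi : Function.Injective i)
    (hex : f.ker = i.range) [UniqueProds N] [UniqueProds Q] : UniqueProds G where
  uniqueMul_of_nonempty {A B} hA hB := by
    classical
    obtain ⟨q, hq, r, hr, hu⟩ :=
      UniqueProds.uniqueMul_of_nonempty (hA.image f) (hB.image f)
    obtain ⟨a, ha, rfl⟩ := Finset.mem_image.mp hq
    obtain ⟨b, hb, rfl⟩ := Finset.mem_image.mp hr
    have hker {g : G} (hg : f g = 1) : ∃ n, i n = g := by
      have : g ∈ f.ker := hg
      rwa [hex] at this
    let A' : Finset N := A.preimage (fun n ↦ a * i n)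
      ((mul_right_injective a).comp hi).injOn
    let B' : Finset N := B.preimage (fun n ↦ i n * b)
      ((mul_left_injective b).comp hi).injOn
    obtain ⟨m, hm, n, hn, hmn⟩ := UniqueProds.uniqueMul_of_nonempty (A := A') (B := B')
      ⟨1, by simpa [A'] using ha⟩ ⟨1, by simpa [B'] using hb⟩
    have hfi (n : N) : f (i n) = 1 := by
      have : i n ∈ f.ker := hex ▸ ⟨n, rfl⟩
      exact this
    refine ⟨a * i m, by simpa [A'] using hm, i n * b, by simpa [B'] using hn,
      UniqueMul.of_image_filter f.toMulHom (aH := f a) (bH := f b)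
        (by simp [hfi]) (by simp [hfi]) hu ?_⟩
    intro x y hx hy hxy
    obtain ⟨hxA, hxa⟩ := Finset.mem_filter.mp hx
    obtain ⟨hyB, hyb⟩ := Finset.mem_filter.mp hy
    obtain ⟨u, hu⟩ := hker (g := a⁻¹ * x) (by simpa [inv_mul_eq_one] using hxa.symm)
    obtain ⟨v, hv⟩ := hker (g := y * b⁻¹) (by simpa [mul_inv_eq_one] using hyb)
    obtain rfl : a * i u = x := by simp [hu]
    obtain rfl : i v * b = y := by simp [hv]
    have h := hmn (a := u) (b := v) (by simpa [A'] using hxA) (by simpa [B'] using hyB)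
      (hi (mul_left_cancel (a := a) (mul_right_cancel (b := b)
        (by simpa only [map_mul, mul_assoc] using hxy))))
    rw [h.1, h.2]
    exact ⟨rfl, rfl⟩

end UniqueProds

section PTFA

theorem uniqueProds_and_hasFolnerSets_of_extension {N G Q : Type*} [Group N] [Group G]
    [CommGroup Q] [IsMulTorsionFree Q] (i : N →* G) (f : G →* Q) (hi : Function.Injective i)
    (hf : Function.Surjective f) (hex : f.ker = i.range)
    (hN : UniqueProds N ∧ HasFolnerSets N) : UniqueProds G ∧ HasFolnerSets G := by
  have := hN.1
  have := UniqueProds.of_isMulTorsionFree Q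
  exact ⟨.of_extension i f hi hex, .of_extension i f hi hf hex hN.2 (.of_commGroup Q)⟩

theorem Subgroup.uniqueProds_and_hasFolnerSets_of_le {Γ : Type*} [Group Γ] {H K : Subgroup Γ}
    (hKH : K ≤ H) (hnormal : ∀ x ∈ H, ∀ y ∈ K, x * y * x⁻¹ ∈ K)
    (hcomm : ∀ x ∈ H, ∀ y ∈ H, x * y * x⁻¹ * y⁻¹ ∈ K)
    (htf : ∀ x ∈ H, ∀ m : ℕ, 0 < m → x ^ m ∈ K → x ∈ K)
    (hK : UniqueProds K ∧ HasFolnerSets K) : UniqueProds H ∧ HasFolnerSets H := by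
  have hn : (K.subgroupOf H).Normal := ⟨fun y hy x ↦ hnormal x x.2 y hy⟩
  let _ : CommGroup (H ⧸ K.subgroupOf H) :=
    { (inferInstance : Group (H ⧸ K.subgroupOf H)) with
      mul_comm := by
        intro a b
        induction a using QuotientGroup.induction_on with | _ x
        induction b using QuotientGroup.induction_on with | _ y
        rw [← mul_inv_eq_one, mul_inv_rev, ← mul_assoc]
        change ((x * y * x⁻¹ * y⁻¹ : H) : H ⧸ K.subgroupOf H) = 1
        rw [QuotientGroup.eq_one_iff]
        exact hcomm x x.2 y y.2 }
  have : IsMulTorsionFree (H ⧸ K.subgroupOf H) := by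
    refine ⟨fun n hn a b hab ↦ ?_⟩
    have h : (a / b) ^ n = 1 := by rw [div_pow, div_eq_one]; exact hab
    rw [← div_eq_one]
    generalize a / b = x at h
    induction x using QuotientGroup.induction_on with | _ x
    rw [← QuotientGroup.mk_pow, QuotientGroup.eq_one_iff] at h
    rw [QuotientGroup.eq_one_iff]
    exact htf x x.2 n (Nat.pos_of_ne_zero hn) h
  exact uniqueProds_and_hasFolnerSets_of_extension (Subgroup.inclusion hKH)
    (QuotientGroup.mk' (K.subgroupOf H)) (Subgroup.inclusion_injective hKH)
    (QuotientGroup.mk'_surjective _)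
    (by rw [QuotientGroup.ker_mk', Subgroup.inclusion_range]) hK

theorem IsPTFA.uniqueProds_and_hasFolnerSets {Γ : Type*} [Group Γ] (h : IsPTFA Γ) :
    UniqueProds Γ ∧ HasFolnerSets Γ := by
  obtain ⟨k, s, h0, hk, hle, hnormal, hcomm, htf⟩ := h
  have key : UniqueProds (s 0) ∧ HasFolnerSets (s 0) := by
    refine Nat.decreasingInduction' (P := fun i ↦ UniqueProds (s i) ∧ HasFolnerSets (s i))
      (fun i hi _ ih ↦ Subgroup.uniqueProds_and_hasFolnerSets_of_le (hle i hi) (hnormal i hi)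
        (hcomm i hi) (htf i hi) ih) (Nat.zero_le k) ?_
    rw [hk]
    let _ : CommGroup (⊥ : Subgroup Γ) :=
      { (inferInstance : Group (⊥ : Subgroup Γ)) with mul_comm := fun _ _ ↦ Subsingleton.elim _ _ }
    have := UniqueProds.of_isMulTorsionFree (⊥ : Subgroup Γ)
    exact ⟨this, .of_commGroup _⟩
  rw [h0] at key
  exact uniqueProds_and_hasFolnerSets_of_extension (Subgroup.subtype ⊤) (1 : Γ →* Unit)
    (Subgroup.subtype_injective _) (fun _ ↦ ⟨1, rfl⟩) (by simp) key

end PTFA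

section Ore

theorem MonoidAlgebra.finrank_supported (k : Type*) [Field k] {G : Type*} (F : Finset G) :
    Module.finrank k (MonoidAlgebra.supported k k (F : Set G)) = F.card := by
  rw [MonoidAlgebra.supported_eq_map, LinearEquiv.finrank_map_eq,
    (Finsupp.supportedEquivFinsupp (F : Set G)).finrank_eq]
  simp

theorem MonoidAlgebra.rightOreCondition_of_hasFolnerSets (k : Type*) [Field k] {G : Type*}
    [Group G] [UniqueProds G] (hG : HasFolnerSets G) :
    RightOreCondition (MonoidAlgebra k G) := by
  classical
  intro x s hs
  obtain ⟨F, hF, hFc⟩ := hG (x.coeff.support ∪ s.coeff.support) (3 / 2) (by norm_num)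
  set S := x.coeff.support ∪ s.coeff.support
  have hmem {a t : MonoidAlgebra k G} (ha : a.coeff.support ⊆ S)
      (ht : t ∈ supported k k (F : Set G)) : a * t ∈ supported k k ((S * F : Finset G) : Set G) := by
    rw [mem_supported, Finset.coe_subset] at ht ⊢
    exact (support_coeff_mul_subset ..).trans (Finset.mul_subset_mul ha ht)
  let V := supported k k (F : Set G)
  let W := supported k k ((S * F : Finset G) : Set G)
  let φ : V × V →ₗ[k] W := LinearMap.codRestrict W
    ((LinearMap.mulLeft k x ∘ₗ V.subtype).coprod (-(LinearMap.mulLeft k s ∘ₗ V.subtype)))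
    (fun v ↦ by
      simpa using W.add_mem (hmem Finset.subset_union_left v.1.2)
        (W.neg_mem (hmem Finset.subset_union_right v.2.2)))
  have : Module.Finite k V := Module.finite_of_finrank_pos (by
    rw [finrank_supported]; exact hF.card_pos)
  have : Module.Finite k W := by
    obtain h | h := (S * F).eq_empty_or_nonempty
    · have : W = ⊥ := by
        simp [W, h, SetLike.ext_iff, mem_supported, MonoidAlgebra.ext_iff, Finsupp.ext_iff]
      rw [this]; infer_instance
    · exact Module.finite_of_finrank_pos (by rw [finrank_supported]; exact h.card_pos)
  have hlt : Module.finrank k W < Module.finrank k (V × V) := by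
    rw [Module.finrank_prod, finrank_supported, finrank_supported]
    have : (0 : ℝ) < F.card := by exact_mod_cast hF.card_pos
    have : ((S * F).card : ℝ) < (F.card + F.card : ℕ) := by push_cast; linarith
    exact_mod_cast this
  obtain ⟨⟨t, y⟩, hv, hne⟩ := (Submodule.ne_bot_iff _).mp (φ.ker_ne_bot_of_finrank_lt hlt)
  have heq : x * (t : MonoidAlgebra k G) = s * (y : MonoidAlgebra k G) := by
    have := congrArg Subtype.val hv
    simpa [φ, ← sub_eq_add_neg, sub_eq_zero] using this
  refine ⟨y, t, fun ht ↦ hne ?_, heq⟩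
  rw [ht, mul_zero, eq_comm, mul_eq_zero] at heq
  have hy := heq.resolve_left hs
  simp_all

open MulOpposite in
theorem RightOreCondition.embedsInSkewQuotientField {A : Type u} [Ring A] [IsDomain A]
    (h : RightOreCondition A) : EmbedsInSkewQuotientField A := by
  have hore : Nonempty (OreLocalization.OreSet (Aᵐᵒᵖ)⁰) := by
    rw [OreLocalization.nonempty_oreSet_iff_of_noZeroDivisors]
    intro r s
    obtain ⟨y, t, ht, hxy⟩ := h r.unop (s : Aᵐᵒᵖ).unop (by simp)
    exact ⟨op y, ⟨op t, mem_nonZeroDivisors_of_ne_zero (by simpa using ht)⟩,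
      unop_injective (by simpa using hxy)⟩
  obtain ⟨_⟩ := hore
  let L := OreLocalization (Aᵐᵒᵖ)⁰ Aᵐᵒᵖ
  let ν : Aᵐᵒᵖ →+* L := OreLocalization.numeratorRingHom
  have hν : Function.Injective ν := OreLocalization.numeratorHom_inj inf_le_left
  let ι : A →+* Lᵐᵒᵖ := (RingHom.op ν).comp (RingEquiv.opOp A).toRingHom
  have hι (a : A) : ι a = op (ν (op a)) := rfl
  refine ⟨Lᵐᵒᵖ, inferInstance, ι, fun a b hab ↦ op_injective (hν (op_injective hab)), fun q ↦ ?_⟩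
  obtain ⟨q⟩ := q
  induction q using OreLocalization.ind with | _ r s
  refine ⟨r.unop, (s : Aᵐᵒᵖ).unop, by simp, ?_⟩
  have hs : ν s ≠ 0 := (map_ne_zero_iff ν hν).mpr (by simp)
  rw [hι, hι, ← op_inv, ← op_mul]
  refine congrArg op ?_
  exact ((inv_mul_eq_iff_eq_mul₀ hs).mpr OreLocalization.mul_cancel.symm).symm

theorem IsPTFA.rightOreCondition_and_embedsInSkewQuotientField {Γ : Type u} [Group Γ]
    (hΓ : IsPTFA Γ) (k : Type) [Field k] : RightOreCondition (MonoidAlgebra k Γ) ∧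
      EmbedsInSkewQuotientField (MonoidAlgebra k Γ) := by
  obtain ⟨_, hF⟩ := hΓ.uniqueProds_and_hasFolnerSets
  have h := MonoidAlgebra.rightOreCondition_of_hasFolnerSets k hF
  exact ⟨h, h.embedsInSkewQuotientField⟩

end Ore

/-- If `Γ` is PTFA and `R = ℚ` or `R = ℤ/pℤ` (`p` prime), then the group ring `RΓ` is a right
Ore domain, and consequently embeds into a skew quotient field. -/
theorem ptfa_groupRing_ore (p : ℕ) (hp : Nat.Prime p)
    (Γ : Type u) [Group Γ] (hΓ : IsPTFA Γ) :
    (RightOreCondition (MonoidAlgebra ℚ Γ) ∧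
      EmbedsInSkewQuotientField (MonoidAlgebra ℚ Γ)) ∧
    (RightOreCondition (MonoidAlgebra (ZMod p) Γ) ∧
      EmbedsInSkewQuotientField (MonoidAlgebra (ZMod p) Γ)) := by
  have := Fact.mk hp
  exact ⟨hΓ.rightOreCondition_and_embedsInSkewQuotientField ℚ,
    hΓ.rightOreCondition_and_embedsInSkewQuotientField (ZMod p)⟩
end

section
/- Let p be a prime, let n be a natural number, and let 𝒫 = (R_0, …, R_n) be the sequence with R_k = ℚ for 0 ≤ k ≤ n−1 and R_n = ℤ_p = ℤ/pℤ. Then for every group G: (a) for each 0 ≤ k ≤ n−1, the quotient group 𝒫^kG/𝒫^{k+1}G is torsion-free abelian; (b) the quotient group 𝒫^nG/𝒫^{n+1}G is an elementary abelian p-group, i.e., every element of it has order 1 or p; and (c) if 𝒫^nG ≠ 𝒫^{n+1}G, then the quotient group G/𝒫^{n+1}G contains an element of order exactly p. -/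
/-- The kernel of the natural homomorphism `N → (N/[N,N]) ⊗_ℤ R`, i.e. of the abelianization
map followed by `x ↦ x ⊗ 1`, as a subgroup of `N`. -/
def tensorKernel (N : Type*) [Group N] (R : Type*) [CommRing R] : Subgroup N where
  carrier := {x : N |
    (Additive.ofMul (Abelianization.of x) ⊗ₜ[ℤ] (1 : R) :
      TensorProduct ℤ (Additive (Abelianization N)) R) = 0}
  one_mem' := by
    simp only [Set.mem_setOf_eq, map_one, ofMul_one, TensorProduct.zero_tmul]
  mul_mem' := by
    intro a b ha hb
    simp only [Set.mem_setOf_eq] at ha hb ⊢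
    rw [map_mul, ofMul_mul, TensorProduct.add_tmul, ha, hb, add_zero]
  inv_mem' := by
    intro a ha
    simp only [Set.mem_setOf_eq] at ha ⊢
    rw [map_inv, ofMul_inv, TensorProduct.neg_tmul, ha, neg_zero]

/-- The `𝒫`-mixed-coefficient commutator series of `G` for a sequence `𝒫 = (R_0, R_1, …)` of
commutative rings with unity: `𝒫^0 G = G`, and `𝒫^{k+1} G` is the kernel of the natural
homomorphism `𝒫^k G → (𝒫^k G/[𝒫^k G, 𝒫^k G]) ⊗_ℤ R_k`. -/
def mixedSeries (P : ℕ → Type*) [∀ k, CommRing (P k)] (G : Type*) [Group G] :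
    ℕ → Subgroup G
  | 0 => ⊤
  | k + 1 =>
      Subgroup.map (mixedSeries P G k).subtype
        (tensorKernel (mixedSeries P G k) (P k))

/-- The coefficient sequence `𝒫 = (R_0, …, R_n)` with `R_k = ℚ` for `k < n` and `R_k = ℤ/pℤ`
for `k ≥ n` (only the terms `R_0, …, R_n` are ever used in `mixedSeries` up to level `n+1`). -/
def mixedQZp (p n : ℕ) : ℕ → Type := fun k => if k < n then ℚ else ZMod p

noncomputable instance (p n k : ℕ) : CommRing (mixedQZp p n k) := by
  unfold mixedQZp
  by_cases h : k < n
  · rw [if_pos h]; infer_instance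
  · rw [if_neg h]; infer_instance

theorem mem_tensorKernel_iff {N : Type*} [Group N] {R : Type*} [CommRing R] {x : N} :
    x ∈ tensorKernel N R ↔
      (Additive.ofMul (Abelianization.of x) ⊗ₜ[ℤ] (1 : R) :
        TensorProduct ℤ (Additive (Abelianization N)) R) = 0 :=
  Iff.rfl

theorem map_mem_tensorKernel {N M : Type*} [Group N] [Group M] {R : Type*} [CommRing R]
    (f : N →* M) {x : N} (hx : x ∈ tensorKernel N R) : f x ∈ tensorKernel M R := by
  rw [mem_tensorKernel_iff] at hx ⊢
  simpa using congrArg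
    (TensorProduct.map (MonoidHom.toAdditive (Abelianization.map f)).toIntLinearMap
      (LinearMap.id : R →ₗ[ℤ] R)) hx

instance tensorKernel_characteristic (N : Type*) [Group N] (R : Type*) [CommRing R] :
    (tensorKernel N R).Characteristic :=
  Subgroup.characteristic_iff_le_comap.mpr fun φ _ hx =>
    map_mem_tensorKernel φ.toMonoidHom hx

theorem commutator_mem_tensorKernel {N : Type*} [Group N] (R : Type*) [CommRing R] (x y : N) :
    x * y * x⁻¹ * y⁻¹ ∈ tensorKernel N R := by
  rw [mem_tensorKernel_iff]
  have h : Abelianization.of (x * y * x⁻¹ * y⁻¹) = 1 := by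
    simp only [map_mul, map_inv]
    rw [mul_comm (Abelianization.of x), mul_inv_cancel_right, mul_inv_cancel]
  rw [h, ofMul_one, TensorProduct.zero_tmul]

theorem pow_mem_tensorKernel_iff {N : Type*} [Group N] {R : Type*} [CommRing R] {x : N} {m : ℕ} :
    x ^ m ∈ tensorKernel N R ↔
      (Additive.ofMul (Abelianization.of x) ⊗ₜ[ℤ] (m : R) :
        TensorProduct ℤ (Additive (Abelianization N)) R) = 0 := by
  have h : (m : R) = (m : ℤ) • (1 : R) := by simp
  rw [mem_tensorKernel_iff, map_pow, ofMul_pow, ← natCast_zsmul, TensorProduct.smul_tmul, h]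

theorem mem_tensorKernel_of_pow_mem {N : Type*} [Group N] {R : Type*} [CommRing R] {x : N}
    {m : ℕ} (hm : IsUnit (m : R)) (hx : x ^ m ∈ tensorKernel N R) : x ∈ tensorKernel N R := by
  obtain ⟨r, hr⟩ := hm.exists_left_inv
  rw [pow_mem_tensorKernel_iff] at hx
  rw [mem_tensorKernel_iff]
  simpa [hr] using congrArg
    (LinearMap.lTensor (Additive (Abelianization N))
      (AddMonoidHom.mulLeft r).toIntLinearMap) hx

theorem pow_mem_tensorKernel {N : Type*} [Group N] {R : Type*} [CommRing R] (x : N)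
    {m : ℕ} (hm : (m : R) = 0) : x ^ m ∈ tensorKernel N R := by
  rw [pow_mem_tensorKernel_iff, hm, TensorProduct.tmul_zero]

section mixedSeries

variable (P : ℕ → Type*) [∀ k, CommRing (P k)] (G : Type*) [Group G]

theorem mixedSeries_normal (k : ℕ) : (mixedSeries P G k).Normal := by
  induction k with
  | zero => exact Subgroup.normal_of_characteristic ⊤
  | succ k ih => exact ConjAct.normal_of_characteristic_of_normal

variable {P G}

theorem mem_mixedSeries_succ_iff {k : ℕ} (x : mixedSeries P G k) :
    (x : G) ∈ mixedSeries P G (k + 1) ↔ x ∈ tensorKernel (mixedSeries P G k) (P k) :=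
  Subgroup.mem_map_iff_mem (mixedSeries P G k).subtype_injective

theorem mixedSeries_succ_le (k : ℕ) : mixedSeries P G (k + 1) ≤ mixedSeries P G k :=
  Subgroup.map_subtype_le _

theorem commutator_mem_mixedSeries_succ {k : ℕ} {x y : G} (hx : x ∈ mixedSeries P G k)
    (hy : y ∈ mixedSeries P G k) : x * y * x⁻¹ * y⁻¹ ∈ mixedSeries P G (k + 1) :=
  (mem_mixedSeries_succ_iff _).mpr
    (commutator_mem_tensorKernel (P k) (⟨x, hx⟩ : mixedSeries P G k) ⟨y, hy⟩)

theorem mem_mixedSeries_succ_of_pow_mem {k m : ℕ} (hm : IsUnit (m : P k)) {x : G}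
    (hx : x ∈ mixedSeries P G k) (h : x ^ m ∈ mixedSeries P G (k + 1)) :
    x ∈ mixedSeries P G (k + 1) :=
  (mem_mixedSeries_succ_iff ⟨x, hx⟩).mpr <| mem_tensorKernel_of_pow_mem hm <|
    (mem_mixedSeries_succ_iff (⟨x, hx⟩ ^ m)).mp h

theorem pow_mem_mixedSeries_succ {k m : ℕ} (hm : (m : P k) = 0) {x : G}
    (hx : x ∈ mixedSeries P G k) : x ^ m ∈ mixedSeries P G (k + 1) :=
  (mem_mixedSeries_succ_iff _).mpr
    (pow_mem_tensorKernel (⟨x, hx⟩ : mixedSeries P G k) hm)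

theorem exists_orderOf_eq_of_mixedSeries_ne_succ {k p : ℕ} (hp : p.Prime) (h0 : (p : P k) = 0)
    (hne : mixedSeries P G k ≠ mixedSeries P G (k + 1)) :
    ∃ _ : (mixedSeries P G (k + 1)).Normal, ∃ g : G ⧸ mixedSeries P G (k + 1), orderOf g = p := by
  have : Fact p.Prime := ⟨hp⟩
  obtain ⟨x, hx, hx'⟩ := SetLike.exists_of_lt (lt_of_le_of_ne (mixedSeries_succ_le k) hne.symm)
  refine ⟨mixedSeries_normal P G (k + 1), (x : G ⧸ mixedSeries P G (k + 1)), ?_⟩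
  have := mixedSeries_normal P G (k + 1)
  refine orderOf_eq_prime ?_ ?_
  · rw [← QuotientGroup.mk_pow, QuotientGroup.eq_one_iff]
    exact pow_mem_mixedSeries_succ h0 hx
  · rwa [Ne, QuotientGroup.eq_one_iff]

end mixedSeries

theorem nonempty_ringEquiv_mpr {R S : Type} (h : R = S) (h' : CommRing R = CommRing S)
    [inst : CommRing S] :
    letI : CommRing R := h'.mpr inst
    Nonempty (R ≃+* S) := by
  subst h
  exact ⟨RingEquiv.refl _⟩

theorem mixedQZp_nonempty_ringEquiv_rat {p n k : ℕ} (h : k < n) :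
    Nonempty (mixedQZp p n k ≃+* ℚ) := by
  have hR : mixedQZp p n k = ℚ := if_pos h
  have hi : instCommRingMixedQZp p n k = (congrArg CommRing hR).mpr inferInstance := by
    unfold instCommRingMixedQZp
    simp only [dif_pos h]
    rfl
  rw [hi]
  exact nonempty_ringEquiv_mpr hR _

theorem mixedQZp_nonempty_ringEquiv_zmod {p n k : ℕ} (h : ¬ k < n) :
    Nonempty (mixedQZp p n k ≃+* ZMod p) := by
  have hR : mixedQZp p n k = ZMod p := if_neg h
  have hi : instCommRingMixedQZp p n k = (congrArg CommRing hR).mpr inferInstance := by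
    unfold instCommRingMixedQZp
    simp only [dif_neg h]
    rfl
  rw [hi]
  exact nonempty_ringEquiv_mpr hR _

theorem mixedQZp_isUnit_natCast {p n k m : ℕ} (h : k < n) (hm : 0 < m) :
    IsUnit (m : mixedQZp p n k) := by
  obtain ⟨e⟩ := mixedQZp_nonempty_ringEquiv_rat (p := p) h
  rw [← MulEquiv.isUnit_map e, map_natCast]
  exact isUnit_iff_ne_zero.mpr (Nat.cast_ne_zero.mpr hm.ne')

theorem mixedQZp_natCast_self (p n : ℕ) : (p : mixedQZp p n n) = 0 := by
  obtain ⟨e⟩ := mixedQZp_nonempty_ringEquiv_zmod (p := p) (lt_irrefl n)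
  apply e.injective
  rw [map_natCast, map_zero, ZMod.natCast_self]

/-- For `𝒫 = (ℚ, …, ℚ, ℤ/pℤ)` (with `ℚ` in positions `0,…,n−1` and `ℤ/pℤ` in position `n`):
(a) for `k < n` the quotient `𝒫^k G/𝒫^{k+1} G` is torsion-free abelian;
(b) the quotient `𝒫^n G/𝒫^{n+1} G` is an elementary abelian `p`-group (every element has
order `1` or `p`); and
(c) if `𝒫^n G ≠ 𝒫^{n+1} G` then `G/𝒫^{n+1} G` contains an element of order exactly `p`.
The quotient conditions in (a), (b) are expressed elementwise. -/
theorem mixedSeries_QZp_quotients (p : ℕ) (hp : Nat.Prime p) (n : ℕ)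
    (G : Type*) [Group G] :
    -- (a) for each `0 ≤ k ≤ n−1`, `𝒫^k G/𝒫^{k+1} G` is torsion-free abelian
    (∀ k, k < n →
      (∀ x ∈ mixedSeries (mixedQZp p n) G k, ∀ y ∈ mixedSeries (mixedQZp p n) G k,
        x * y * x⁻¹ * y⁻¹ ∈ mixedSeries (mixedQZp p n) G (k + 1)) ∧
      (∀ x ∈ mixedSeries (mixedQZp p n) G k, ∀ m : ℕ, 0 < m →
        x ^ m ∈ mixedSeries (mixedQZp p n) G (k + 1) →
        x ∈ mixedSeries (mixedQZp p n) G (k + 1))) ∧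
    -- (b) `𝒫^n G/𝒫^{n+1} G` is an elementary abelian `p`-group
    ((∀ x ∈ mixedSeries (mixedQZp p n) G n, ∀ y ∈ mixedSeries (mixedQZp p n) G n,
        x * y * x⁻¹ * y⁻¹ ∈ mixedSeries (mixedQZp p n) G (n + 1)) ∧
      (∀ x ∈ mixedSeries (mixedQZp p n) G n,
        x ^ p ∈ mixedSeries (mixedQZp p n) G (n + 1))) ∧
    -- (c) if `𝒫^n G ≠ 𝒫^{n+1} G`, then `G/𝒫^{n+1} G` has an element of order exactly `p`
    (mixedSeries (mixedQZp p n) G n ≠ mixedSeries (mixedQZp p n) G (n + 1) →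
      ∃ _ : (mixedSeries (mixedQZp p n) G (n + 1)).Normal,
        ∃ g : G ⧸ mixedSeries (mixedQZp p n) G (n + 1), orderOf g = p) :=
  ⟨fun _ hk => ⟨fun _ hx _ hy => commutator_mem_mixedSeries_succ hx hy,
      fun _ hx _ hm h => mem_mixedSeries_succ_of_pow_mem (mixedQZp_isUnit_natCast hk hm) hx h⟩,
    ⟨fun _ hx _ hy => commutator_mem_mixedSeries_succ hx hy,
      fun _ hx => pow_mem_mixedSeries_succ (mixedQZp_natCast_self p n) hx⟩,
    exists_orderOf_eq_of_mixedSeries_ne_succ hp (mixedQZp_natCast_self p n)⟩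
end
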